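/- For integers 2 ≤ j ≤ n let A(n,j) := Σ_{k=0}^{n-j} (-1)^k · (n-1)! / ((j-1)! · k! · (n-j-k)!) · h_{j-1}/h_{j+k-1}, and set L(n) := Σ_{j=2}^n A(n,j). Then there is a constant C such that for all n ≥ 2, |L(n) - (3/π²)·h_{n-1}² - (ζ(3)/ζ(2)²)·h_{n-1} - ζ(3)²/ζ(2)³ - 1/10 + (3/π²)·ψ'(n)| ≤ C · n^{-1-|s₁|}, where ψ'(n) = Σ_{k=0}^∞ 1/(n+k)² is the trigamma function at n, h_m = Σ_{i=1}^m 1/i, ζ(2) = π²/6, ζ(3) = Σ_{k≥1} k^{-3}, and s₁ ∈ (-1,0) is the unique root of ψ(s) = ψ(1) in (-1,0). -/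

import Mathlib

/-- The digamma function on the reals: `ψ(x) = Γ'(x)/Γ(x)`. -/
noncomputable def digamma (x : ℝ) : ℝ := deriv Real.Gamma x / Real.Gamma x

/-- The `m`-th harmonic number `h_m = ∑_{i=1}^m 1/i`, with `h_0 = 0`. -/
noncomputable def harm (m : ℕ) : ℝ := ∑ i ∈ Finset.range m, (1 : ℝ) / (i + 1)

/-- `A(n,j) = Σ_{k=0}^{n-j} (-1)^k (n-1)!/((j-1)!·k!·(n-j-k)!) · h_{j-1}/h_{j+k-1}`. -/
noncomputable def A (n j : ℕ) : ℝ :=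
  ∑ k ∈ Finset.range (n - j + 1),
    (-1 : ℝ) ^ k * ((n - 1).factorial : ℝ) /
      (((j - 1).factorial : ℝ) * (k.factorial : ℝ) * ((n - j - k).factorial : ℝ)) *
      (harm (j - 1) / harm (j + k - 1))

/-- `L(n) = Σ_{j=2}^n A(n,j)` (equal to `E[L_n]` in the paper). -/
noncomputable def L (n : ℕ) : ℝ := ∑ j ∈ Finset.Icc 2 n, A n j

/-- `ζ(3) = Σ_{k≥1} k⁻³`. -/
noncomputable def zeta3 : ℝ := ∑' k : ℕ, (1 : ℝ) / ((k : ℝ) + 1) ^ 3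

/-- The trigamma function `ψ'(x) = Σ_{k=0}^∞ 1/(x+k)²`. -/
noncomputable def trigamma (x : ℝ) : ℝ := ∑' k : ℕ, 1 / (x + (k : ℝ)) ^ 2

/-- alternating binomial sum -/
def altSum {K : Type*} [Field K] (N : ℕ) (u : ℕ → K) : K :=
  ∑ i ∈ Finset.range (N + 1), (-1) ^ i * (N.choose i : K) * u i

theorem altSum_succ {K : Type*} [Field K] (N : ℕ) (u : ℕ → K) :
    altSum (N + 1) u = altSum N u - altSum N (fun i => u (i + 1)) := by
  unfold altSum
  rw [Finset.sum_range_succ' _ (N + 1)]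
  have h : ∀ i, (-1 : K) ^ (i + 1) * ((N + 1).choose (i + 1) : K) * u (i + 1)
      = (-1 : K) ^ (i + 1) * (N.choose (i + 1) : K) * u (i + 1)
        - (-1 : K) ^ i * (N.choose i : K) * u (i + 1) := by
    intro i
    rw [Nat.choose_succ_succ]; push_cast; ring
  simp only [h, Finset.sum_sub_distrib]
  rw [Finset.sum_range_succ (fun i => (-1 : K) ^ (i + 1) * (N.choose (i + 1) : K) * u (i + 1)) N,
    Finset.sum_range_succ' (fun i => (-1 : K) ^ i * (N.choose i : K) * u i) N]
  simp
  ring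

theorem altSum_inv {K : Type*} [Field K] (N : ℕ) (s : K) (hs : ∀ k ≤ N, s + k ≠ 0) :
    altSum N (fun i => 1 / (s + i)) = N.factorial / ∏ k ∈ Finset.range (N + 1), (s + k) := by
  induction N generalizing s with
  | zero => simp [altSum]
  | succ N ih =>
    rw [altSum_succ, ih s (fun k hk => hs k (by omega))]
    have h1 := ih (s + 1) (fun k hk => by have := hs (k + 1) (by omega); push_cast at this; rwa [add_right_comm, add_assoc])
    have h2 : (fun i : ℕ => 1 / (s + ((i + 1 : ℕ) : K))) = fun i : ℕ => 1 / (s + 1 + (i : K)) := by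
      funext i; push_cast; ring_nf
    rw [h2, h1]
    have e1 : ∏ k ∈ Finset.range (N + 1 + 1), (s + (k : K))
        = s * ∏ k ∈ Finset.range (N + 1), (s + 1 + (k : K)) := by
      rw [Finset.prod_range_succ', mul_comm]
      push_cast
      simp [add_assoc, add_comm (1 : K)]
    have e2 : ∏ k ∈ Finset.range (N + 1 + 1), (s + (k : K))
        = (∏ k ∈ Finset.range (N + 1), (s + (k : K))) * (s + (N + 1)) := by
      rw [Finset.prod_range_succ]; push_cast; rfl
    have n0 : ∏ k ∈ Finset.range (N + 1 + 1), (s + (k : K)) ≠ 0 := by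
      rw [Finset.prod_ne_zero_iff]
      intro k hk
      exact hs k (by have := Finset.mem_range.1 hk; omega)
    have n1 := n0
    rw [e2] at n1
    have n2 := n0
    rw [e1] at n2
    have n3 := left_ne_zero_of_mul n1
    have n4 := right_ne_zero_of_mul n1
    have n5 := left_ne_zero_of_mul n2
    have n6 := right_ne_zero_of_mul n2
    have f : ((N + 1).factorial : K) = (N + 1) * N.factorial := by
      rw [Nat.factorial_succ]; push_cast; ring
    rw [f]
    set P := ∏ k ∈ Finset.range (N + 1 + 1), (s + (k : K)) with hP
    have a1 : (N.factorial : K) / ∏ k ∈ Finset.range (N + 1), (s + (k : K))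
        = N.factorial * (s + (N + 1)) / P := by
      rw [e2]; field_simp
    have a2 : (N.factorial : K) / ∏ k ∈ Finset.range (N + 1), (s + 1 + (k : K))
        = N.factorial * s / P := by
      rw [e1]; field_simp
    rw [a1, a2]; ring

theorem altSum_neg_shift (N : ℕ) (u : ℕ → ℝ) :
    altSum (N + 1) u - altSum N u = (1 / (N + 1)) * altSum (N + 1) (fun i => i * u i) := by
  rw [altSum_succ]
  unfold altSum
  rw [Finset.sum_range_succ' _ (N + 1)]
  simp only [Nat.cast_zero, zero_mul, mul_zero, add_zero, sub_sub_cancel_left, Finset.mul_sum]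
  rw [← Finset.sum_neg_distrib]
  refine Finset.sum_congr rfl fun i _ => ?_
  have h := Nat.add_one_mul_choose_eq N i
  have h' : ((N : ℝ) + 1) * (N.choose i) = ((N + 1).choose (i + 1)) * (i + 1) := by exact_mod_cast h
  have hN : (N : ℝ) + 1 ≠ 0 := by positivity
  have : (N.choose i : ℝ) = ((N + 1).choose (i + 1)) * (i + 1) / (N + 1) := by
    field_simp; linarith
  rw [this]; push_cast; field_simp; ring

theorem harm_succ (N : ℕ) : harm (N + 1) = harm N + 1 / (N + 1) := by
  simp [harm, Finset.sum_range_succ]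

theorem harm_pos (N : ℕ) : 0 < harm (N + 1) := by
  unfold harm
  exact Finset.sum_pos (fun i _ => by positivity) ⟨0, by simp⟩

theorem altSum_const (N : ℕ) : altSum (N + 1) (fun _ => (1 : ℝ)) = 0 := by
  rw [altSum_succ]; simp

theorem altSum_one_div (N : ℕ) : altSum N (fun i => (1 : ℝ) / i) = - harm N := by
  induction N with
  | zero => simp [altSum, harm]
  | succ N ih =>
    have h := altSum_neg_shift N (fun i => (1 : ℝ) / i)
    have h2 : altSum (N + 1) (fun i => (i : ℝ) * (1 / i)) = -1 := by
      have := altSum_const N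
      unfold altSum at this ⊢
      rw [Finset.sum_range_succ'] at this ⊢
      have e : ∀ i : ℕ, ((i + 1 : ℕ) : ℝ) * (1 / ((i + 1 : ℕ) : ℝ)) = 1 := fun i => by
        push_cast; field_simp
      simp only [e]
      simp at this ⊢
      linarith
    rw [h2, ih] at h
    rw [harm_succ]
    linarith

/-- second order harmonic -/
noncomputable def harm2 (m : ℕ) : ℝ := ∑ i ∈ Finset.range m, (1 : ℝ) / (i + 1) ^ 2

theorem altSum_one_div_sq (N : ℕ) :
    altSum N (fun i => (1 : ℝ) / (i : ℝ) ^ 2) = - (harm N ^ 2 + harm2 N) / 2 := by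
  induction N with
  | zero => simp [altSum, harm, harm2]
  | succ N ih =>
    have h := altSum_neg_shift N (fun i => (1 : ℝ) / (i : ℝ) ^ 2)
    have h2 : (fun i : ℕ => (i : ℝ) * (1 / (i : ℝ) ^ 2)) = fun i : ℕ => (1 : ℝ) / i := by
      funext i
      rcases Nat.eq_zero_or_pos i with rfl | hi
      · simp
      · have : (i : ℝ) ≠ 0 := by positivity
        field_simp
    rw [h2, ih, altSum_one_div, harm_succ] at h
    have h3 : harm2 (N + 1) = harm2 N + 1 / (N + 1) ^ 2 := by
      simp [harm2, Finset.sum_range_succ]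
    rw [h3, harm_succ]
    have hN : (N : ℝ) + 1 ≠ 0 := by positivity
    field_simp at h ⊢
    linarith

theorem altSum_harm (N : ℕ) : altSum (N + 1) harm = - (1 / (N + 1)) := by
  rw [altSum_succ]
  have h : altSum N harm - altSum N (fun i => harm (i + 1))
      = - altSum N (fun i => 1 / ((1 : ℝ) + i)) := by
    unfold altSum
    rw [← Finset.sum_sub_distrib, ← Finset.sum_neg_distrib]
    refine Finset.sum_congr rfl fun i _ => ?_
    simp only [harm_succ]; ring
  rw [h, altSum_inv N 1 (fun k _ => by positivity)]
  have : ∏ k ∈ Finset.range (N + 1), ((1 : ℝ) + k) = (N + 1).factorial := by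
    rw [← Finset.prod_range_add_one_eq_factorial]; push_cast
    exact Finset.prod_congr rfl fun i _ => add_comm _ _
  rw [this, Nat.factorial_succ]; push_cast
  have : (N.factorial : ℝ) ≠ 0 := by positivity
  field_simp

theorem L_eq (N : ℕ) : L (N + 1) = - altSum N (fun i => 1 / (i * harm i)) := by
  have hA : ∀ m ∈ Finset.Icc 1 N, A (N + 1) (m + 1) = ∑ i ∈ Finset.Icc m N,
      (-1 : ℝ) ^ (i + m) * (N.choose i) * (i.choose m) * (harm m / harm i) := by
    intro m hm
    rw [Finset.mem_Icc] at hm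
    unfold A
    have : Finset.Icc m N = Finset.Ico m (N + 1) := by ext; simp <;> omega
    rw [this, Finset.sum_Ico_eq_sum_range]
    have : N + 1 - (m + 1) + 1 = N + 1 - m := by omega
    rw [this]
    refine Finset.sum_congr rfl fun k hk => ?_
    rw [Finset.mem_range] at hk
    have e1 : m + 1 + k - 1 = m + k := by omega
    have e2 : N + 1 - (m + 1) - k = N - (m + k) := by omega
    simp only [Nat.add_sub_cancel, e1, e2]
    have c1 := Nat.choose_mul_factorial_mul_factorial (show m + k ≤ N by omega)
    have c2 := Nat.choose_mul_factorial_mul_factorial (show m ≤ m + k by omega)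
    have e3 : m + k - m = k := by omega
    rw [e3] at c2
    have c3 : (N.factorial : ℝ) = N.choose (m + k) * ((m + k).choose m * m.factorial * k.factorial)
        * (N - (m + k)).factorial := by
      rw [← c1, ← c2]; push_cast; ring
    rw [c3]
    have p1 : (m.factorial : ℝ) ≠ 0 := by positivity
    have p2 : (k.factorial : ℝ) ≠ 0 := by positivity
    have p3 : ((N - (m + k)).factorial : ℝ) ≠ 0 := by positivity
    have p4 : (-1 : ℝ) ^ (m + k + m) = (-1) ^ k := by
      rw [show m + k + m = k + 2 * m by ring, pow_add, pow_mul]; simp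
    rw [p4]
    field_simp
  have hL : L (N + 1) = ∑ m ∈ Finset.Icc 1 N, A (N + 1) (m + 1) := by
    unfold L
    have e1 : Finset.Icc 2 (N + 1) = Finset.Ico (1 + 1) (N + 1 + 1) := by ext; simp <;> omega
    have e2 : Finset.Icc 1 N = Finset.Ico 1 (N + 1) := by ext; simp <;> omega
    rw [e1, e2, Finset.sum_Ico_add' (fun j => A (N + 1) j)]
  rw [hL, Finset.sum_congr rfl hA]
  rw [Finset.sum_comm' (t' := Finset.Icc 1 N) (s' := fun i => Finset.Icc 1 i)
    (by intro x y; simp only [Finset.mem_Icc]; omega)]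
  unfold altSum
  rw [Finset.sum_range_succ']
  have e3 : Finset.Icc 1 N = Finset.Ico (0 + 1) (N + 1) := by ext; simp <;> omega
  rw [e3, ← Finset.sum_Ico_add' _ 0 N 1, Nat.Ico_zero_eq_range]
  simp only [Nat.cast_zero, zero_mul, div_zero, mul_zero, add_zero]
  rw [← Finset.sum_neg_distrib]
  refine Finset.sum_congr rfl fun i _ => ?_
  have hh := altSum_harm i
  unfold altSum at hh
  rw [Finset.sum_range_succ'] at hh
  have e4 : Finset.Icc 1 (i + 1) = Finset.Ico (0 + 1) (i + 1 + 1) := by ext; simp <;> omega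
  rw [e4, ← Finset.sum_Ico_add' _ 0 (i + 1) 1, Nat.Ico_zero_eq_range]
  have hz : harm 0 = 0 := by simp [harm]
  rw [hz, mul_zero, add_zero] at hh
  have hp := (harm_pos i).ne'
  calc _ = (-1 : ℝ) ^ (i + 1) * (N.choose (i + 1)) / harm (i + 1) *
      ∑ m ∈ Finset.range (i + 1), (-1 : ℝ) ^ (m + 1) * ((i + 1).choose (m + 1)) * harm (m + 1) := by
        rw [Finset.mul_sum]
        refine Finset.sum_congr rfl fun m _ => ?_
        rw [pow_add (-1 : ℝ) (i + 1) (m + 1)]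
        ring
    _ = _ := by
        rw [hh]; push_cast
        field_simp

open Filter Topology

theorem digamma_rec (x : ℝ) (hx : ∀ m : ℕ, x ≠ -m) : digamma (x + 1) = digamma x + 1 / x := by
  have h0 : x ≠ 0 := by simpa using hx 0
  have hG := Real.Gamma_ne_zero hx
  have hd := Real.differentiableAt_Gamma hx
  have hder : deriv Real.Gamma (x + 1) = Real.Gamma x + x * deriv Real.Gamma x := by
    rw [← deriv_comp_add_const]
    have e : (fun y => Real.Gamma (y + 1)) =ᶠ[𝓝 x] fun y => y * Real.Gamma y := by
      filter_upwards [isOpen_ne.mem_nhds h0] with y hy using Real.Gamma_add_one hy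
    rw [e.deriv_eq]
    have := (hasDerivAt_id x).mul hd.hasDerivAt
    have h2 := this.deriv
    simp only [id, one_mul] at h2
    exact h2
  unfold digamma
  rw [hder, Real.Gamma_add_one h0]
  field_simp
  ring

theorem digamma_eq_deriv_log {x : ℝ} (hx : 0 < x) :
    digamma x = deriv (Real.log ∘ Real.Gamma) x := by
  rw [Function.comp_def, deriv.log (Real.differentiableAt_Gamma (fun m => by
    have : (0 : ℝ) ≤ m := m.cast_nonneg
    linarith)) (Real.Gamma_pos_of_pos hx).ne']
  rfl

theorem logGamma_diff {x : ℝ} (hx : 0 < x) : DifferentiableAt ℝ (Real.log ∘ Real.Gamma) x := by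
  refine ((Real.differentiableAt_Gamma ?_).log (Real.Gamma_ne_zero ?_)) <;>
    exact fun m ↦ ne_of_gt (by have : (0 : ℝ) ≤ m := m.cast_nonneg
                               linarith)

theorem logGamma_rec {x : ℝ} (hx : 0 < x) : (Real.log ∘ Real.Gamma) (x + 1)
    = (Real.log ∘ Real.Gamma) x + Real.log x := by
  simp only [Function.comp_apply,
      Real.Gamma_add_one hx.ne', Real.log_mul hx.ne' (Real.Gamma_pos_of_pos hx).ne', add_comm]

theorem digamma_le_log {x : ℝ} (hx : 0 < x) : digamma x ≤ Real.log x := by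
  rw [digamma_eq_deriv_log hx]
  have := Real.convexOn_log_Gamma.deriv_le_slope (x := x) (y := x + 1) hx
    (show (0 : ℝ) < x + 1 by linarith) (by linarith) (logGamma_diff hx)
  rw [slope_def_field, logGamma_rec hx] at this
  simpa using this

theorem log_le_digamma {x : ℝ} (hx : 0 < x) : Real.log x ≤ digamma (x + 1) := by
  have h1 : 0 < x + 1 := by linarith
  rw [digamma_eq_deriv_log h1]
  have := Real.convexOn_log_Gamma.slope_le_deriv (x := x) (y := x + 1) hx
    h1 (by linarith) (logGamma_diff h1)
  rw [slope_def_field, logGamma_rec hx] at this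
  simpa using this

theorem digamma_add_nat (x : ℝ) (hx : ∀ m : ℕ, x ≠ -m) (n : ℕ) :
    digamma (x + n) = digamma x + ∑ k ∈ Finset.range n, 1 / (x + k) := by
  induction n with
  | zero => simp
  | succ n ih =>
    rw [Finset.sum_range_succ, ← add_assoc, ← ih]
    push_cast
    rw [← add_assoc]
    apply digamma_rec
    intro m h
    apply hx (n + m)
    push_cast
    linarith

theorem root_sum (s : ℝ) (hs : s ∈ Set.Ioo (-1 : ℝ) 0) (hroot : digamma s = digamma 1) :
    Tendsto (fun n : ℕ => ∑ k ∈ Finset.range n, (1 / (1 + (k : ℝ)) - 1 / (s + k))) atTop (𝓝 0) := by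
  have hne : ∀ m : ℕ, s ≠ -m := by
    intro m h
    rcases m with _ | m
    · simp at h; linarith [hs.2]
    · have : (0 : ℝ) ≤ m := m.cast_nonneg
      push_cast at h; linarith [hs.1]
  rw [← tendsto_add_atTop_iff_nat 3]
  have hb : ∀ p : ℕ, ‖∑ k ∈ Finset.range (p + 3), (1 / (1 + (k : ℝ)) - 1 / (s + k))‖
      ≤ 3 * (1 / ((p : ℝ) + 1)) := by
    intro p
    have hp : (0 : ℝ) ≤ p := p.cast_nonneg
    have h1 := digamma_add_nat s hne (p + 3)
    have h2 := digamma_add_nat 1 (fun m => by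
      have : (0 : ℝ) ≤ m := m.cast_nonneg
      linarith) (p + 3)
    have a1 := log_le_digamma (x := s + p + 2) (by linarith [hs.1])
    have a2 := digamma_le_log (x := s + p + 3) (by linarith [hs.1])
    have b1 := log_le_digamma (x := 1 + p + 2) (by linarith [hs.1])
    have b2 := digamma_le_log (x := 1 + p + 3) (by linarith [hs.1])
    have e1 : s + p + 2 + 1 = s + ((p + 3 : ℕ) : ℝ) := by push_cast; ring
    have e2 : s + p + 3 = s + ((p + 3 : ℕ) : ℝ) := by push_cast; ring
    have e3 : (1 : ℝ) + p + 2 + 1 = 1 + ((p + 3 : ℕ) : ℝ) := by push_cast; ring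
    have e4 : (1 : ℝ) + p + 3 = 1 + ((p + 3 : ℕ) : ℝ) := by push_cast; ring
    rw [e1] at a1
    rw [e2] at a2
    rw [e3] at b1
    rw [e4] at b2
    have c1 : Real.log ((p : ℝ) + 1) ≤ Real.log (s + p + 2) :=
      Real.log_le_log (by linarith) (by linarith [hs.1])
    have c2 : Real.log (s + ((p + 3 : ℕ) : ℝ)) ≤ Real.log (1 + p + 2) :=
      Real.log_le_log (by push_cast; linarith [hs.1]) (by push_cast; linarith [hs.2])
    have c3 : Real.log (1 + ((p + 3 : ℕ) : ℝ)) - Real.log ((p : ℝ) + 1) ≤ 3 * (1 / ((p : ℝ) + 1)) := by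
      rw [← Real.log_div (by positivity) (by positivity)]
      refine (Real.log_le_sub_one_of_pos (by positivity)).trans (le_of_eq ?_)
      push_cast
      field_simp
      ring
    rw [Finset.sum_sub_distrib, Real.norm_eq_abs, abs_le]
    have : (0 : ℝ) ≤ 3 * (1 / ((p : ℝ) + 1)) := by positivity
    constructor <;> linarith
  refine squeeze_zero_norm hb ?_
  simpa using (tendsto_one_div_add_atTop_nhds_zero_nat (𝕜 := ℝ)).const_mul 3


theorem dist_circle (X R c : ℝ) (hc : 0 < c) (hR : R = X + c) (k : ℝ) (hk : k ≤ X)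
    (z : ℂ) (hz : ‖z - X‖ = R) : k + c ≤ ‖z - k‖ := by
  have h1 : ‖z - X‖ ≤ ‖z - k‖ + ‖(k : ℂ) - X‖ := by
    have := norm_add_le (z - k) ((k : ℂ) - X)
    simpa using this
  have h2 : ‖(k : ℂ) - X‖ = X - k := by
    rw [← Complex.ofReal_sub, Complex.norm_real, Real.norm_eq_abs, abs_sub_comm,
      abs_of_nonneg (by linarith)]
  linarith

theorem kernel_bound (N : ℕ) (c X R : ℝ) (hc : 0 < c) (hR : R = X + c) (hX : (N : ℝ) ≤ X)
    (z : ℂ) (hz : ‖z - X‖ = R) :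
    ‖altSum N (fun i => (z - i)⁻¹)‖
      ≤ (N.factorial / ∏ k ∈ Finset.range (N + 1), (c + (k : ℝ))) * c / ‖z‖ := by
  have hdist : ∀ k ≤ N, (k : ℝ) + c ≤ ‖z - k‖ := by
    intro k hk
    have := dist_circle X R c hc hR k (le_trans (by exact_mod_cast hk) hX) z hz
    simpa using this
  have hpos : ∀ k ≤ N, 0 < ‖z - k‖ := fun k hk =>
    lt_of_lt_of_le (by positivity) (hdist k hk)
  have h1 : altSum N (fun i => (z - i)⁻¹) = - altSum N (fun i => 1 / (-z + i)) := by
    unfold altSum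
    rw [← Finset.sum_neg_distrib]
    refine Finset.sum_congr rfl fun i _ => ?_
    have : (-z + i) = - (z - i) := by ring
    simp only [this, one_div, inv_neg]
    ring
  rw [h1, altSum_inv N (-z) (fun k hk h => by
    have := hpos k hk
    rw [show z - k = -(-z + k) by ring, h] at this
    simp at this), norm_neg, norm_div, norm_prod, Complex.norm_natCast]
  have h2 : ∀ k : ℕ, ‖-z + (k : ℂ)‖ = ‖z - k‖ := fun k => by
    rw [show z - k = -(-z + k) by ring, norm_neg]
  simp only [h2]
  rw [Finset.prod_range_succ', Finset.prod_range_succ']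
  have h0 := hpos 0 (Nat.zero_le _)
  simp only [Nat.cast_zero, sub_zero, add_zero] at h0 ⊢
  have hP : 0 < ∏ k ∈ Finset.range N, (c + ((k + 1 : ℕ) : ℝ)) :=
    Finset.prod_pos fun k _ => by positivity
  have hle : ∏ k ∈ Finset.range N, (c + ((k + 1 : ℕ) : ℝ)) ≤ ∏ k ∈ Finset.range N, ‖z - ((k + 1 : ℕ) : ℂ)‖ := by
    refine Finset.prod_le_prod (fun k _ => by positivity) fun k hk => ?_
    have := hdist (k + 1) (by have := Finset.mem_range.1 hk; omega)
    linarith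
  have e : (N.factorial : ℝ) / ((∏ k ∈ Finset.range N, (c + ((k + 1 : ℕ) : ℝ))) * c) * c / ‖z‖
      = N.factorial / ((∏ k ∈ Finset.range N, (c + ((k + 1 : ℕ) : ℝ))) * ‖z‖) := by
    field_simp
  rw [e]
  gcongr

theorem poisson_integral (c X R : ℝ) (hc : 0 < c) (hR : R = X + c) (hX : 0 ≤ X) :
    ∫ θ in (0 : ℝ)..2 * Real.pi, poissonKernel (X : ℂ) 0 (circleMap X R θ) = 2 * Real.pi := by
  have h := DiffContOnCl.circleAverage_poissonKernel_smul (E := ℂ) (f := fun _ => (1 : ℂ))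
    (c := (X : ℂ)) (R := R) (w := 0) diffContOnCl_const (by
      rw [Metric.mem_ball, dist_eq_norm, zero_sub, norm_neg, Complex.norm_real, Real.norm_eq_abs,
        abs_of_nonneg hX]
      linarith)
  rw [Real.circleAverage_def] at h
  simp only [Pi.smul_apply', Complex.real_smul, mul_one] at h
  rw [intervalIntegral.integral_ofReal, ← Complex.ofReal_mul] at h
  have h2 : (2 * Real.pi)⁻¹ * ∫ θ in (0 : ℝ)..2 * Real.pi, poissonKernel (X : ℂ) 0 (circleMap X R θ) = 1 := by
    exact_mod_cast h
  have := Real.two_pi_pos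
  field_simp at h2
  linarith

theorem rice_bound (h : ℂ → ℂ) (c d B : ℝ) (hc : 0 < c) (hcd : c < d)
    (hd : DifferentiableOn ℂ h {s | -d < s.re})
    (hB : ∀ s : ℂ, -c ≤ s.re → ‖h s‖ * ‖s‖ ≤ B) (N : ℕ) :
    ‖altSum N (fun i => h i)‖ ≤ B * (N.factorial / ∏ k ∈ Finset.range (N + 1), (c + (k : ℝ))) := by
  obtain ⟨X, hX⟩ : ∃ X : ℝ, X = N + 1 := ⟨_, rfl⟩
  obtain ⟨R, hR⟩ : ∃ R : ℝ, R = X + c := ⟨_, rfl⟩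
  have hN : (0 : ℝ) ≤ N := N.cast_nonneg
  have hRpos : 0 < R := by linarith
  have hre : ∀ s : ℂ, ‖s - X‖ ≤ R → -c ≤ s.re := by
    intro s hs
    have := (Complex.abs_re_le_norm (s - X)).trans hs
    rw [abs_le] at this
    simp at this
    linarith
  have hball : DifferentiableOn ℂ h (Metric.closedBall (X : ℂ) R) := by
    refine hd.mono fun s hs => ?_
    have := hre s (by simpa [dist_eq_norm] using hs)
    show -d < s.re
    linarith
  have hcau : ∀ i ≤ N, (∮ z in C((X : ℂ), R), (z - (i : ℂ))⁻¹ • h z) = (2 * Real.pi * Complex.I : ℂ) • h i := by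
    intro i hi
    apply hball.circleIntegral_sub_inv_smul
    rw [Metric.mem_ball, dist_eq_norm, ← Complex.ofReal_natCast, ← Complex.ofReal_sub, Complex.norm_real,
      Real.norm_eq_abs, abs_lt]
    have : (i : ℝ) ≤ N := by exact_mod_cast hi
    have : (0 : ℝ) ≤ i := i.cast_nonneg
    constructor <;> linarith
  have hne : ∀ i ≤ N, ∀ z ∈ Metric.sphere (X : ℂ) R, z - (i : ℂ) ≠ 0 := by
    intro i hi z hz h0
    have h1 := dist_circle X R c hc hR i (by
      have : (i : ℝ) ≤ N := by exact_mod_cast hi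
      linarith) z (by simpa [dist_eq_norm] using hz)
    have : (0 : ℝ) ≤ i := i.cast_nonneg
    rw [Complex.ofReal_natCast, h0, norm_zero] at h1
    linarith
  have hsum : (∮ z in C((X : ℂ), R), altSum N (fun i => (z - (i : ℂ))⁻¹) * h z)
      = (2 * Real.pi * Complex.I : ℂ) * altSum N (fun i => h i) := by
    unfold altSum
    simp only [Finset.sum_mul, Finset.mul_sum]
    rw [circleIntegral.integral_fun_sum]
    · refine Finset.sum_congr rfl fun i hi => ?_
      have := hcau i (by have := Finset.mem_range.1 hi; omega)
      simp only [smul_eq_mul] at this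
      simp only [mul_assoc]
      rw [circleIntegral.integral_const_mul, circleIntegral.integral_const_mul, this]
      ring
    · intro i hi
      apply ContinuousOn.circleIntegrable hRpos.le
      have hi' : i ≤ N := by have := Finset.mem_range.1 hi; omega
      refine ContinuousOn.mul (ContinuousOn.mul continuousOn_const ?_)
        (hball.continuousOn.mono Metric.sphere_subset_closedBall)
      exact ContinuousOn.inv₀ (by fun_prop) (hne i hi')
  set P := (N.factorial / ∏ k ∈ Finset.range (N + 1), (c + (k : ℝ))) with hP
  have hPpos : 0 ≤ P := by
    rw [hP]
    refine div_nonneg (by positivity) (Finset.prod_nonneg fun k _ => by positivity)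
  have hB0 : 0 ≤ B := by simpa using hB 0 (by simpa using hc.le)
  have hRX : 0 < R ^ 2 - X ^ 2 := by rw [hR]; nlinarith
  have hbound : ‖∮ z in C((X : ℂ), R), altSum N (fun i => (z - (i : ℂ))⁻¹) * h z‖
      ≤ ∫ θ in (0 : ℝ)..2 * Real.pi, (R * B * P * c / (R ^ 2 - X ^ 2)) *
          poissonKernel (X : ℂ) 0 (circleMap X R θ) := by
    apply intervalIntegral.norm_integral_le_of_norm_le Real.two_pi_pos.le
    · refine Filter.Eventually.of_forall fun θ _ => ?_
      have hz : ‖circleMap (X : ℂ) R θ - X‖ = R := by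
        simp [circleMap, abs_of_pos hRpos]
      set z := circleMap (X : ℂ) R θ with hzd
      have hk := kernel_bound N c X R hc hR (by linarith) z hz
      have hz0 : 0 < ‖z‖ := by
        have := dist_circle X R c hc hR 0 (by linarith) z hz
        simp at this; linarith
      have hb := hB z (hre z hz.le)
      rw [norm_smul, deriv_circleMap, norm_mul, Complex.norm_I, mul_one, norm_circleMap_zero, abs_of_pos hRpos, norm_mul]
      rw [poissonKernel_def, hz]
      have e : ‖(0 : ℂ) - X‖ = X := by
        simp; linarith
      have e2 : z - X - (0 - X) = z := by ring
      rw [e, e2]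
      have hb' : ‖h z‖ ≤ B / ‖z‖ := by rw [le_div_iff₀ hz0]; exact hb
      calc R * (‖altSum N (fun i => (z - (i : ℂ))⁻¹)‖ * ‖h z‖)
          ≤ R * ((P * c / ‖z‖) * (B / ‖z‖)) := by gcongr
        _ = _ := by field_simp
    · apply Continuous.intervalIntegrable
      refine Continuous.mul continuous_const ?_
      unfold poissonKernel
      refine Continuous.div (by fun_prop) (by fun_prop) fun θ => ?_
      have hz : ‖circleMap (X : ℂ) R θ - X‖ = R := by
        simp [circleMap, abs_of_pos hRpos]
      have := dist_circle X R c hc hR 0 (by linarith) _ hz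
      have e2 : circleMap (X : ℂ) R θ - X - (0 - X) = circleMap (X : ℂ) R θ := by ring
      rw [e2]
      simp only [Complex.ofReal_zero, sub_zero] at this
      have : 0 < ‖circleMap (X : ℂ) R θ‖ := by linarith
      positivity
  rw [hsum, intervalIntegral.integral_const_mul, poisson_integral c X R hc hR (by linarith), norm_mul] at hbound
  have e : ‖(2 * Real.pi * Complex.I : ℂ)‖ = 2 * Real.pi := by
    simp [abs_of_pos Real.pi_pos]
  rw [e, mul_comm _ (2 * Real.pi)] at hbound
  have := le_of_mul_le_mul_left hbound Real.two_pi_pos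
  refine this.trans ?_
  rw [div_le_iff₀ hRX]
  have : R ^ 2 - X ^ 2 = R * c + X * c := by rw [hR]; ring
  rw [this]
  have h3 : 0 ≤ B * P * (X * c) := by
    have : 0 ≤ X := by linarith
    positivity
  nlinarith

/-- Generic series `∑ a_k / (k+2+s)`. -/
noncomputable def Zf (a : ℕ → ℝ) (s : ℂ) : ℂ := ∑' k : ℕ, (a k : ℂ) / ((k : ℂ) + 2 + s)

theorem den_bound {d : ℝ} (hd1 : 1 ≤ d) (k : ℕ) {s : ℂ} (hs : -d < s.re) :
    (2 - d) * ((k : ℝ) + 1) ≤ ‖(k : ℂ) + 2 + s‖ := by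
  have h := Complex.re_le_norm ((k : ℂ) + 2 + s)
  simp at h
  have : (0 : ℝ) ≤ k := k.cast_nonneg
  nlinarith

theorem den_ne {d : ℝ} (hd1 : 1 ≤ d) (hd2 : d < 2) (k : ℕ) {s : ℂ} (hs : -d < s.re) :
    (k : ℂ) + 2 + s ≠ 0 := by
  have := den_bound hd1 k hs
  intro h
  rw [h, norm_zero] at this
  have h1 : (0 : ℝ) < (k : ℝ) + 1 := by positivity
  have h2 : 0 < 2 - d := by linarith
  have := mul_pos h2 h1
  linarith

theorem term_bound {d C : ℝ} (hd1 : 1 ≤ d) (hd2 : d < 2) (a : ℕ → ℝ)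
    (ha : ∀ k, |a k| ≤ C / ((k : ℝ) + 1)) (k : ℕ) {s : ℂ} (hs : -d < s.re) :
    ‖(a k : ℂ) / ((k : ℂ) + 2 + s)‖ ≤ (C / (2 - d)) * (1 / ((k + 1 : ℕ) : ℝ) ^ 2) := by
  rw [norm_div, Complex.norm_real, Real.norm_eq_abs]
  have h2 : 0 < 2 - d := by linarith
  have hb := den_bound hd1 k hs
  have hk : (0 : ℝ) < (k : ℝ) + 1 := by positivity
  have hp : 0 < (2 - d) * ((k : ℝ) + 1) := by positivity
  calc |a k| / ‖(k : ℂ) + 2 + s‖ ≤ (C / ((k : ℝ) + 1)) / ((2 - d) * ((k : ℝ) + 1)) :=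
        div_le_div₀ ((abs_nonneg _).trans (ha k)) (ha k) hp hb
    _ = _ := by push_cast; field_simp

theorem sq_summable (C : ℝ) : Summable (fun k : ℕ => C * (1 / ((k + 1 : ℕ) : ℝ) ^ 2)) :=
  ((summable_nat_add_iff 1).2 (Real.summable_one_div_nat_pow.2 one_lt_two)).mul_left _

theorem Zf_summable {d C : ℝ} (hd1 : 1 ≤ d) (hd2 : d < 2) (a : ℕ → ℝ)
    (ha : ∀ k, |a k| ≤ C / ((k : ℝ) + 1)) {s : ℂ} (hs : -d < s.re) :
    Summable (fun k : ℕ => (a k : ℂ) / ((k : ℂ) + 2 + s)) :=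
  Summable.of_norm_bounded (sq_summable _) (fun k => term_bound hd1 hd2 a ha k hs)

theorem Zf_diff {d C : ℝ} (hd1 : 1 ≤ d) (hd2 : d < 2) (a : ℕ → ℝ)
    (ha : ∀ k, |a k| ≤ C / ((k : ℝ) + 1)) :
    DifferentiableOn ℂ (Zf a) {s | -d < s.re} := by
  unfold Zf
  refine Complex.differentiableOn_tsum_of_summable_norm (sq_summable (C / (2 - d))) (fun k => ?_)
    (isOpen_lt continuous_const Complex.continuous_re) (fun k s hs => term_bound hd1 hd2 a ha k hs)
  intro s hs
  refine DifferentiableWithinAt.div (by fun_prop) (by fun_prop) (den_ne hd1 hd2 k hs)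

noncomputable def aQ (k : ℕ) : ℝ := 1 / ((k : ℝ) + 2)
noncomputable def aV (k : ℕ) : ℝ := 1 / ((k : ℝ) + 2) ^ 3
noncomputable def aY (σ : ℝ) (k : ℕ) : ℝ := 1 / (((k : ℝ) + 2) * ((k : ℝ) + 2 + σ))

theorem aQ_bound (k : ℕ) : |aQ k| ≤ 1 / ((k : ℝ) + 1) := by
  unfold aQ
  rw [abs_of_nonneg (by positivity)]
  apply one_div_le_one_div_of_le <;> first | positivity | linarith

theorem aV_bound (k : ℕ) : |aV k| ≤ 1 / ((k : ℝ) + 1) := by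
  unfold aV
  rw [abs_of_nonneg (by positivity)]
  have : (0 : ℝ) ≤ k := k.cast_nonneg
  apply one_div_le_one_div_of_le
  · positivity
  · calc (k : ℝ) + 1 ≤ (k + 2) ^ 1 := by linarith
      _ ≤ _ := pow_le_pow_right₀ (by linarith) (by norm_num)

theorem aY_bound (σ : ℝ) (hσ : -2 < σ) (k : ℕ) : |aY σ k| ≤ (1 / (2 + σ)) / ((k : ℝ) + 1) := by
  unfold aY
  have hk : (0 : ℝ) ≤ k := k.cast_nonneg
  have h1 : 0 < 2 + σ := by linarith
  have h2 : 0 < (k : ℝ) + 2 + σ := by linarith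
  rw [abs_of_nonneg (by positivity), div_div]
  apply one_div_le_one_div_of_le
  · positivity
  · nlinarith

theorem Q_sub (σ d : ℝ) (hd1 : 1 ≤ d) (hd2 : d < 2) (hσ : -d < σ) {s : ℂ} (hs : -d < s.re) :
    Zf aQ s - Zf aQ σ = -(s - σ) * Zf (aY σ) s := by
  have hσ' : -d < (σ : ℂ).re := by simpa using hσ
  unfold Zf
  rw [← (Zf_summable hd1 hd2 aQ aQ_bound hs).tsum_sub (Zf_summable hd1 hd2 aQ aQ_bound hσ'),
    ← tsum_mul_left]
  congr 1
  funext k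
  have h1 := den_ne hd1 hd2 k hs
  have h2 := den_ne hd1 hd2 k hσ'
  have h3 : (k : ℂ) + 2 ≠ 0 := by exact_mod_cast (by positivity : (k : ℝ) + 2 ≠ 0)
  unfold aQ aY
  push_cast
  field_simp
  ring

theorem z2_hasSum : HasSum (fun k : ℕ => 1 / ((k : ℝ) + 2) ^ 2) (Real.pi ^ 2 / 6 - 1) := by
  have := (hasSum_nat_add_iff' 2).2 hasSum_zeta_two
  simpa [Finset.sum_range_succ] using this

theorem z4_hasSum : HasSum (fun k : ℕ => 1 / ((k : ℝ) + 2) ^ 4) (Real.pi ^ 4 / 90 - 1) := by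
  have := (hasSum_nat_add_iff' 2).2 hasSum_zeta_four
  simpa [Finset.sum_range_succ] using this


theorem z3_hasSum : HasSum (fun k : ℕ => 1 / ((k : ℝ) + 2) ^ 3) (zeta3 - 1) := by
  have h0 : Summable (fun k : ℕ => (1 : ℝ) / ((k : ℝ) + 1) ^ 3) := by
    have := (summable_nat_add_iff 1).2 (Real.summable_one_div_nat_pow.2 (show 1 < 3 by norm_num))
    simpa using this
  have := (hasSum_nat_add_iff' 1).2 h0.hasSum
  simp only [Finset.sum_range_one] at this
  have e : (fun k : ℕ => 1 / ((k : ℝ) + 2) ^ 3) = fun k : ℕ => 1 / (((k + 1 : ℕ) : ℝ) + 1) ^ 3 := by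
    funext k
    push_cast
    rw [show (k : ℝ) + 1 + 1 = k + 2 by ring]
  rw [e]
  simpa [zeta3] using this

theorem Q_expand (d : ℝ) (hd1 : 1 ≤ d) (hd2 : d < 2) {s : ℂ} (hs : -d < s.re) :
    Zf aQ s = ((Real.pi ^ 2 / 6 - 1 : ℝ) : ℂ) - s * ((zeta3 - 1 : ℝ) : ℂ) + s ^ 2 * Zf aV s := by
  have h2 := Complex.hasSum_ofReal.2 z2_hasSum
  have h3 := (Complex.hasSum_ofReal.2 z3_hasSum).mul_left s
  have h4 := ((Zf_summable hd1 hd2 aV aV_bound hs).hasSum).mul_left (s ^ 2)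
  have := ((h2.sub h3).add h4).tsum_eq
  unfold Zf
  rw [← this]
  congr 1
  funext k
  have h1 := den_ne hd1 hd2 k hs
  have h3 : (k : ℂ) + 2 ≠ 0 := by exact_mod_cast (by positivity : (k : ℝ) + 2 ≠ 0)
  unfold aQ aV
  push_cast
  field_simp
  ring

theorem V_zero : Zf aV 0 = ((Real.pi ^ 4 / 90 - 1 : ℝ) : ℂ) := by
  have h := (Complex.hasSum_ofReal.2 z4_hasSum).tsum_eq
  rw [← h]
  unfold Zf
  congr 1
  funext k
  have h3 : (k : ℂ) + 2 ≠ 0 := by exact_mod_cast (by positivity : (k : ℝ) + 2 ≠ 0)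
  unfold aV
  push_cast
  rw [add_zero]
  field_simp

theorem term_im (p : ℝ) (hp : 0 < p) (s : ℂ) (h : (p : ℂ) + s ≠ 0) :
    (s * (((1 / p : ℝ) : ℂ) / (p + s))).im = s.im / Complex.normSq (p + s) := by
  have hp' : (p : ℂ) ≠ 0 := by exact_mod_cast hp.ne'
  have : s * (((1 / p : ℝ) : ℂ) / (p + s)) = ((1 / p : ℝ) : ℂ) - ((p : ℂ) + s)⁻¹ := by
    push_cast; field_simp; ring
  rw [this, Complex.sub_im, Complex.ofReal_im, Complex.inv_im]
  simp
  ring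

theorem term_re (p : ℝ) (hp : 0 < p) (s : ℂ) (hs : 0 ≤ s.re) :
    1 / p - 1 / (p + s.re) ≤ (s * (((1 / p : ℝ) : ℂ) / (p + s))).re := by
  have hp' : (p : ℂ) ≠ 0 := by exact_mod_cast hp.ne'
  have hre : 0 < p + s.re := by linarith
  have h : (p : ℂ) + s ≠ 0 := by
    intro h
    have := congrArg Complex.re h
    simp at this
    linarith
  have : s * (((1 / p : ℝ) : ℂ) / (p + s)) = ((1 / p : ℝ) : ℂ) - ((p : ℂ) + s)⁻¹ := by
    push_cast; field_simp; ring
  rw [this, Complex.sub_re, Complex.ofReal_re, Complex.inv_re]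
  have hn : Complex.normSq ((p : ℂ) + s) = (p + s.re) ^ 2 + s.im ^ 2 := by
    rw [Complex.normSq_apply]; simp; ring
  rw [hn]
  have : ((p : ℂ) + s).re / ((p + s.re) ^ 2 + s.im ^ 2) ≤ 1 / (p + s.re) := by
    rw [div_le_div_iff₀ (by positivity) hre]
    simp
    nlinarith [sq_nonneg s.im]
  linarith

/-- complex harmonic function -/
noncomputable def hf (s : ℂ) : ℂ := s * (((1 / (1 : ℝ) : ℝ) : ℂ) / ((1 : ℝ) + s)) + s * Zf aQ s

theorem hf_series (d : ℝ) (hd1 : 1 ≤ d) (hd2 : d < 2) {s : ℂ} (hs : -d < s.re) :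
    HasSum (fun k : ℕ => s * (((1 / ((k : ℝ) + 2) : ℝ) : ℂ) / ((((k : ℝ) + 2 : ℝ) : ℂ) + s)))
      (s * Zf aQ s) := by
  have := ((Zf_summable hd1 hd2 aQ aQ_bound hs).hasSum).mul_left s
  have e : (fun k : ℕ => s * (((1 / ((k : ℝ) + 2) : ℝ) : ℂ) / ((((k : ℝ) + 2 : ℝ) : ℂ) + s)))
      = fun k : ℕ => s * ((aQ k : ℂ) / ((k : ℂ) + 2 + s)) := by
    funext k
    unfold aQ
    push_cast
    rfl
  rw [e]
  exact this

theorem hf_re (s : ℂ) (hs : 1 ≤ s.re) : 1 / 2 ≤ (hf s).re := by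
  have h := Complex.hasSum_re (hf_series 1 le_rfl one_lt_two (s := s) (by linarith))
  unfold hf
  rw [Complex.add_re]
  have h1 := term_re 1 one_pos s (by linarith)
  have h2 : 0 ≤ (s * Zf aQ s).re := by
    refine h.nonneg fun (k : ℕ) => le_trans ?_ (term_re ((k : ℝ) + 2) (by positivity) s (by linarith))
    rw [sub_nonneg]
    apply one_div_le_one_div_of_le (by positivity)
    linarith
  have h3 : 1 / (1 + s.re) ≤ 1 / 2 := by
    apply one_div_le_one_div_of_le (by positivity)
    linarith
  linarith

theorem hf_im_hasSum (d : ℝ) (hd1 : 1 ≤ d) (hd2 : d < 2) {s : ℂ} (hs : -d < s.re) :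
    HasSum (fun k : ℕ => s.im / Complex.normSq ((((k : ℝ) + 2 : ℝ) : ℂ) + s)) (s * Zf aQ s).im := by
  have h := Complex.hasSum_im (hf_series d hd1 hd2 hs)
  convert h using 2 with k
  rw [term_im]
  · positivity
  · have := den_ne hd1 hd2 k hs
    push_cast; exact this

theorem hf_im (s : ℂ) (h0 : s.im ≠ 0) :
    (hf s).im = s.im / Complex.normSq ((1 : ℝ) + s) + (s * Zf aQ s).im := by
  unfold hf
  rw [Complex.add_im, term_im _ one_pos]
  intro h
  have := congrArg Complex.im h
  simp at this
  exact h0 this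

theorem hf_im_ne (d : ℝ) (hd1 : 1 ≤ d) (hd2 : d < 2) {s : ℂ} (hs : -d < s.re) (h0 : s.im ≠ 0) :
    (hf s).im ≠ 0 := by
  rw [hf_im s h0]
  have h := (hf_im_hasSum d hd1 hd2 hs).div_const s.im
  have h1 : 0 ≤ (s * Zf aQ s).im / s.im := by
    refine h.nonneg fun k => ?_
    rw [div_div_cancel_left' h0]
    exact inv_nonneg.2 (Complex.normSq_nonneg _)
  have h2 : 0 < Complex.normSq ((1 : ℝ) + s) := by
    rw [Complex.normSq_pos]
    intro h
    have := congrArg Complex.im h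
    simp at this
    exact h0 this
  intro h3
  have h4 : (s.im / Complex.normSq ((1 : ℝ) + s) + (s * Zf aQ s).im) / s.im = 0 := by rw [h3, zero_div]
  rw [add_div, div_div_cancel_left' h0] at h4
  have := inv_pos.2 h2
  linarith

theorem hf_im_lower (d : ℝ) (hd1 : 1 ≤ d) (hd2 : d < 2) {s : ℂ} (hs : -d < s.re) (hs1 : s.re ≤ 1)
    (h0 : 1 ≤ |s.im|) : 1 / 17 ≤ ‖hf s‖ := by
  have hne : s.im ≠ 0 := by intro h; rw [h] at h0; simp at h0; linarith
  refine le_trans ?_ (Complex.abs_im_le_norm _)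
  rw [hf_im s hne]
  set y := |s.im| with hy
  have hy2 : s.im ^ 2 = y ^ 2 := (sq_abs _).symm
  have h := (hf_im_hasSum d hd1 hd2 hs).mul_left (s.im / y)
  have hyy : s.im / y * s.im = y := by
    field_simp; exact hy2
  have habs : |s.im / y| = 1 := by
    rw [abs_div, ← hy, abs_of_pos (by linarith : 0 < y)]; field_simp
  have key : 1 / 17 ≤ s.im / y * (s * Zf aQ s).im := by
    have hsum := sum_le_hasSum (Finset.range ⌈y⌉₊) (fun k _ => by
      rw [← mul_div_assoc, hyy]
      exact div_nonneg (by linarith) (Complex.normSq_nonneg _)) h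
    refine le_trans ?_ hsum
    have hterm : ∀ k ∈ Finset.range ⌈y⌉₊, 1 / (17 * y) ≤
        s.im / y * (s.im / Complex.normSq ((((k : ℝ) + 2 : ℝ) : ℂ) + s)) := by
      intro k hk
      have hk : (k : ℝ) < y := Nat.lt_ceil.1 (Finset.mem_range.1 hk)
      have hk0 : (0 : ℝ) ≤ k := k.cast_nonneg
      rw [← mul_div_assoc, hyy]
      have hn : Complex.normSq ((((k : ℝ) + 2 : ℝ) : ℂ) + s) = (k + 2 + s.re) ^ 2 + y ^ 2 := by
        rw [Complex.normSq_apply, ← hy2]; simp; ring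
      rw [hn, div_le_div_iff₀ (by positivity) (by positivity)]
      have : (k + 2 + s.re) ^ 2 ≤ (4 * y) ^ 2 := by
        apply pow_le_pow_left₀ <;> linarith
      nlinarith
    have := Finset.card_nsmul_le_sum _ _ _ hterm
    refine le_trans ?_ this
    rw [Finset.card_range, nsmul_eq_mul]
    have hc := Nat.le_ceil y
    rw [mul_one_div, div_le_div_iff₀ (by norm_num) (by positivity)]
    linarith
  have key2 : 0 ≤ s.im / y * (s.im / Complex.normSq ((1 : ℝ) + s)) := by
    rw [← mul_div_assoc, hyy]
    exact div_nonneg (by linarith) (Complex.normSq_nonneg _)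
  calc 1 / 17 ≤ s.im / y * (s.im / Complex.normSq ((1 : ℝ) + s) + (s * Zf aQ s).im) := by
        rw [mul_add]; linarith
    _ ≤ |s.im / y * (s.im / Complex.normSq ((1 : ℝ) + s) + (s * Zf aQ s).im)| := le_abs_self _
    _ = _ := by rw [abs_mul, habs, one_mul]

theorem harm_zero : harm 0 = 0 := by simp [harm]

theorem hf_succ (i : ℕ) : hf ((i + 1 : ℕ) : ℂ) = hf (i : ℂ) + 1 / ((i : ℂ) + 1) := by
  have h1 := hf_series 1 le_rfl one_lt_two (s := ((i + 1 : ℕ) : ℂ)) (by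
    rw [Complex.natCast_re]; have : (0 : ℝ) ≤ (i + 1 : ℕ) := Nat.cast_nonneg _
    linarith)
  have h2 := hf_series 1 le_rfl one_lt_two (s := (i : ℂ)) (by
    rw [Complex.natCast_re]; have : (0 : ℝ) ≤ i := Nat.cast_nonneg _
    linarith)
  have h3 := h1.sub h2
  have hterm : ∀ n : ℕ, ∑ k ∈ Finset.range n,
      (((i + 1 : ℕ) : ℂ) * (((1 / ((k : ℝ) + 2) : ℝ) : ℂ) / ((((k : ℝ) + 2 : ℝ) : ℂ) + ((i + 1 : ℕ) : ℂ)))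
        - (i : ℂ) * (((1 / ((k : ℝ) + 2) : ℝ) : ℂ) / ((((k : ℝ) + 2 : ℝ) : ℂ) + (i : ℂ))))
      = 1 / ((i : ℂ) + 2) - (((n + (2 + i) : ℕ) : ℂ))⁻¹ := by
    intro n
    induction n with
    | zero => simp [add_comm]
    | succ n ih =>
      rw [Finset.sum_range_succ, ih]
      have e1 : (n : ℂ) + 2 ≠ 0 := by exact_mod_cast (by positivity : (n : ℝ) + 2 ≠ 0)
      have e2 : (n : ℂ) + 2 + (i + 1) ≠ 0 := by exact_mod_cast (by positivity : (n : ℝ) + 2 + (i + 1) ≠ 0)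
      have e3 : (n : ℂ) + 2 + i ≠ 0 := by exact_mod_cast (by positivity : (n : ℝ) + 2 + i ≠ 0)
      have e4 : (n : ℂ) + 1 + (2 + i) = n + 2 + (i + 1) := by ring
      have e5 : (n : ℂ) + (2 + i) = n + 2 + i := by ring
      push_cast
      rw [e4, e5]
      field_simp
      ring
  have h4 := h3.tendsto_sum_nat
  simp only [hterm] at h4
  have h5 : Tendsto (fun n : ℕ => 1 / ((i : ℂ) + 2) - (((n + (2 + i) : ℕ) : ℂ))⁻¹) atTop
      (𝓝 (1 / ((i : ℂ) + 2) - 0)) := by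
    refine tendsto_const_nhds.sub ?_
    exact (tendsto_inv_atTop_nhds_zero_nat (𝕜 := ℂ)).comp (tendsto_add_atTop_nat (2 + i))
  have h6 := tendsto_nhds_unique h4 h5
  unfold hf
  have h7 : ((i + 1 : ℕ) : ℂ) * Zf aQ ((i + 1 : ℕ) : ℂ) = (i : ℂ) * Zf aQ (i : ℂ) + 1 / ((i : ℂ) + 2) := by
    rw [sub_zero] at h6
    rw [← h6]; ring
  rw [h7]
  have e2 : (i : ℂ) + 2 ≠ 0 := by exact_mod_cast (by positivity : (i : ℝ) + 2 ≠ 0)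
  have e3 : (1 : ℂ) + i ≠ 0 := by exact_mod_cast (by positivity : (1 : ℝ) + i ≠ 0)
  have e4 : (1 : ℂ) + (i + 1) = i + 2 := by ring
  have e5 : (i : ℂ) + 1 = 1 + i := by ring
  push_cast
  rw [e4, e5]
  field_simp
  ring

theorem hf_nat (i : ℕ) : hf (i : ℂ) = (harm i : ℂ) := by
  induction i with
  | zero => simp [hf, harm_zero]
  | succ i ih => rw [hf_succ, ih, harm_succ]; push_cast; ring

theorem root_Q (σ : ℝ) (hσ : σ ∈ Set.Ioo (-2 : ℝ) (-1)) (hroot : digamma (σ + 1) = digamma 1) :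
    Zf aQ σ = -(1 / (1 + (σ : ℂ))) := by
  have h := root_sum (σ + 1) ⟨by linarith [hσ.1], by linarith [hσ.2]⟩ hroot
  rw [← tendsto_add_atTop_iff_nat 1] at h
  obtain ⟨d, hd1, hd2⟩ : ∃ d : ℝ, -σ < d ∧ d < 2 := exists_between (by linarith [hσ.1])
  have hs := ((Zf_summable (by linarith [hσ.2]) hd2 aQ aQ_bound (s := (σ : ℂ))
    (by simp; linarith)).hasSum.mul_left (σ : ℂ)).tendsto_sum_nat
  have e1 : (σ : ℂ) ≠ 0 := by exact_mod_cast (by linarith [hσ.2] : σ < 0).ne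
  have e2 : 1 + (σ : ℂ) ≠ 0 := by exact_mod_cast (by linarith [hσ.2] : 1 + σ < 0).ne
  have hs2 := hs.add_const ((σ : ℂ) / (1 + σ))
  have h' : Tendsto (fun n : ℕ => ((∑ k ∈ Finset.range (n + 1), (1 / (1 + (k : ℝ)) - 1 / (σ + 1 + k)) : ℝ) : ℂ))
      atTop (𝓝 ((0 : ℝ) : ℂ)) := (Complex.continuous_ofReal.tendsto _).comp h
  have e : (fun n : ℕ => ((∑ k ∈ Finset.range (n + 1), (1 / (1 + (k : ℝ)) - 1 / (σ + 1 + k)) : ℝ) : ℂ))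
      = fun n : ℕ => ∑ k ∈ Finset.range n, (σ : ℂ) * ((aQ k : ℂ) / ((k : ℂ) + 2 + σ)) + (σ : ℂ) / (1 + σ) := by
    funext n
    rw [Finset.sum_range_succ']
    push_cast
    congr 1
    · refine Finset.sum_congr rfl fun k _ => ?_
      have a1 : (k : ℂ) + 2 ≠ 0 := by exact_mod_cast (by positivity : (k : ℝ) + 2 ≠ 0)
      have a2 : (k : ℂ) + 2 + σ ≠ 0 := by
        have : (0 : ℝ) ≤ k := k.cast_nonneg
        exact_mod_cast (by linarith [hσ.1] : 0 < (k : ℝ) + 2 + σ).ne'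
      unfold aQ
      have a3 : (1 : ℂ) + (k + 1) = k + 2 := by ring
      have a4 : (σ : ℂ) + 1 + (k + 1) = k + 2 + σ := by ring
      push_cast
      rw [a3, a4]
      field_simp
      ring
    · rw [add_comm (σ : ℂ) 1, add_zero, add_zero]
      field_simp
      ring
  rw [e] at h'
  have := tendsto_nhds_unique hs2 h'
  change (σ : ℂ) * Zf aQ σ + _ = _ at this
  have h3 : (σ : ℂ) * (Zf aQ σ + 1 / (1 + σ)) = 0 := by
    rw [mul_add, mul_one_div, this]; simp
  have := (mul_eq_zero.1 h3).resolve_left e1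
  linear_combination this

noncomputable def Mf (s : ℂ) : ℂ := 1 + (1 + s) * Zf aQ s
noncomputable def Ef (σ : ℝ) (s : ℂ) : ℂ := -(1 / (1 + (σ : ℂ))) - (1 + s) * Zf (aY σ) s
noncomputable def z2 : ℝ := Real.pi ^ 2 / 6
noncomputable def c2 : ℝ := 1 / z2
noncomputable def c1 : ℝ := zeta3 / z2 ^ 2
noncomputable def nf (s : ℂ) : ℂ :=
  (1 + s) * (c1 * zeta3 : ℝ) - (c2 + c1 * s) * (1 + (1 + s) * Zf aV s)

theorem z2_pos : 0 < z2 := by unfold z2; positivity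

theorem Mf_hf (s : ℂ) (h : 1 + s ≠ 0) : s * Mf s = (1 + s) * hf s := by
  unfold Mf hf
  push_cast
  field_simp

theorem nf_eq (d : ℝ) (hd1 : 1 ≤ d) (hd2 : d < 2) {s : ℂ} (hs : -d < s.re) :
    s ^ 2 * nf s = (1 + s) - (c2 + c1 * s) * Mf s := by
  have hz : (z2 : ℂ) ≠ 0 := by exact_mod_cast z2_pos.ne'
  unfold Mf nf
  rw [Q_expand d hd1 hd2 hs]
  change _ = 1 + s - (c2 + c1 * s) * (1 + (1 + s) * (((z2 - 1 : ℝ) : ℂ) - _ + _))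
  unfold c1 c2
  push_cast
  field_simp
  ring

theorem Mf_fact (σ d : ℝ) (hd1 : 1 ≤ d) (hd2 : d < 2) (hσd : -d < σ) (hσ : σ ∈ Set.Ioo (-2 : ℝ) (-1))
    (hroot : digamma (σ + 1) = digamma 1) {s : ℂ} (hs : -d < s.re) :
    Mf s = (s - σ) * Ef σ s := by
  have h1 := Q_sub σ d hd1 hd2 hσd hs
  rw [root_Q σ hσ hroot] at h1
  have e2 : 1 + (σ : ℂ) ≠ 0 := by exact_mod_cast (by linarith [hσ.2] : 1 + σ < 0).ne
  have h2 : Zf aQ s = -(1 / (1 + (σ : ℂ))) - (s - σ) * Zf (aY σ) s := by linear_combination h1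
  unfold Mf Ef
  rw [h2]
  field_simp
  ring

theorem Zf_real (a : ℕ → ℝ) (x : ℝ) : Zf a x = ((∑' k : ℕ, a k / ((k : ℝ) + 2 + x) : ℝ) : ℂ) := by
  unfold Zf
  push_cast
  rfl

theorem Ef_ne (σ d : ℝ) (hd1 : 1 ≤ d) (hd2 : d < 2) (hσd : -d < σ) (hσ : σ ∈ Set.Ioo (-2 : ℝ) (-1))
    (hroot : digamma (σ + 1) = digamma 1) {s : ℂ} (hs : -d < s.re) : Ef σ s ≠ 0 := by
  have hf1 := Mf_fact σ d hd1 hd2 hσd hσ hroot hs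
  by_cases him : s.im = 0
  · obtain ⟨x, rfl⟩ : ∃ x : ℝ, s = x := ⟨s.re, by apply Complex.ext <;> simp [him]⟩
    rw [Complex.ofReal_re] at hs
    have hk : ∀ k : ℕ, 0 < (k : ℝ) + 2 + x := fun k => by
      have : (0 : ℝ) ≤ k := k.cast_nonneg
      linarith
    by_cases hx : x ≤ -1
    · unfold Ef
      rw [Zf_real]
      have hnn : 0 ≤ ∑' k : ℕ, aY σ k / ((k : ℝ) + 2 + x) := by
        refine tsum_nonneg fun k => div_nonneg ?_ (hk k).le
        unfold aY
        have : (0 : ℝ) ≤ k := k.cast_nonneg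
        have : 0 < (k : ℝ) + 2 + σ := by linarith [hσ.1]
        positivity
      have h1 : 0 < -(1 / (1 + σ)) := by
        have : 1 + σ < 0 := by linarith [hσ.2]
        have := one_div_neg.2 this
        linarith
      have h2 : 0 < -(1 / (1 + σ)) - (1 + x) * ∑' k : ℕ, aY σ k / ((k : ℝ) + 2 + x) := by
        nlinarith
      exact_mod_cast h2.ne'
    · have hnn : 0 ≤ ∑' k : ℕ, aQ k / ((k : ℝ) + 2 + x) := by
        refine tsum_nonneg fun k => div_nonneg ?_ (hk k).le
        unfold aQ
        positivity
      have hM : Mf x ≠ 0 := by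
        unfold Mf
        rw [Zf_real]
        have : 0 < 1 + (1 + x) * ∑' k : ℕ, aQ k / ((k : ℝ) + 2 + x) := by
          have := mul_nonneg (by linarith : 0 ≤ 1 + x) hnn
          linarith
        exact_mod_cast this.ne'
      rw [hf1] at hM
      exact right_ne_zero_of_mul hM
  · have h0 := hf_im_ne d hd1 hd2 hs him
    have h1 : hf s ≠ 0 := by intro h; rw [h] at h0; simp at h0
    have h2 : 1 + s ≠ 0 := by
      intro h
      have := congrArg Complex.im h
      simp at this
      exact him this
    have h3 := mul_ne_zero h2 h1
    rw [← Mf_hf s h2, hf1] at h3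
    exact right_ne_zero_of_mul (right_ne_zero_of_mul h3)

noncomputable def qf (σ : ℝ) (s : ℂ) : ℂ := nf s / Ef σ s
noncomputable def gf (σ : ℝ) : ℂ → ℂ := dslope (qf σ) σ

theorem gf_diff (σ d : ℝ) (hd1 : 1 ≤ d) (hd2 : d < 2) (hσd : -d < σ) (hσ : σ ∈ Set.Ioo (-2 : ℝ) (-1))
    (hroot : digamma (σ + 1) = digamma 1) : DifferentiableOn ℂ (gf σ) {s | -d < s.re} := by
  have hopen : IsOpen {s : ℂ | -d < s.re} := isOpen_lt continuous_const Complex.continuous_re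
  unfold gf
  rw [Complex.differentiableOn_dslope (hopen.mem_nhds (by simpa using hσd))]
  unfold qf
  have hV := Zf_diff hd1 hd2 aV aV_bound
  have hY := Zf_diff hd1 hd2 (aY σ) (aY_bound σ hσ.1)
  refine DifferentiableOn.fun_div ?_ ?_ (fun s hs => Ef_ne σ d hd1 hd2 hσd hσ hroot hs)
  · unfold nf
    fun_prop
  · unfold Ef
    fun_prop

theorem gf_eq (σ d : ℝ) (hd1 : 1 ≤ d) (hd2 : d < 2) (hσd : -d < σ) (hσ : σ ∈ Set.Ioo (-2 : ℝ) (-1))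
    (hroot : digamma (σ + 1) = digamma 1) {s : ℂ} (hs : -d < s.re) (hne : s ≠ σ) :
    nf s / Mf s = qf σ σ * (1 / (s - σ)) + gf σ s := by
  unfold gf
  rw [dslope_of_ne _ hne, slope_def_field, Mf_fact σ d hd1 hd2 hσd hσ hroot hs]
  have h1 := Ef_ne σ d hd1 hd2 hσd hσ hroot hs
  have h2 : s - σ ≠ 0 := sub_ne_zero.2 hne
  have h3 : qf σ s = nf s / Ef σ s := rfl
  rw [h3]
  field_simp
  ring

theorem gf_bound (σ c d : ℝ) (hc1 : 1 ≤ c) (hcd : c < d) (hd2 : d < 2) (hσd : -c < σ)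
    (hσ : σ ∈ Set.Ioo (-2 : ℝ) (-1)) (hroot : digamma (σ + 1) = digamma 1) :
    ∃ B : ℝ, ∀ s : ℂ, -c ≤ s.re → ‖gf σ s‖ * ‖s‖ ≤ B := by
  have hd1 : 1 ≤ d := by linarith
  have hσd' : -d < σ := by linarith
  have hdiff := gf_diff σ d hd1 hd2 hσd' hσ hroot
  have hK : IsCompact (Set.Icc (-c) 1 ×ℂ Set.Icc (-1) 1) := isCompact_Icc.reProdIm isCompact_Icc
  obtain ⟨B1, hB1⟩ := hK.exists_bound_of_continuousOn (f := fun s => gf σ s * s)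
    (ContinuousOn.mul (hdiff.continuousOn.mono (fun s hs => by
      have := (Complex.mem_reProdIm.1 hs).1.1
      show -d < s.re
      linarith)) continuousOn_id)
  refine ⟨max B1 (17 + |c2| + |c1| + ‖qf σ σ‖ * (1 + |σ|)), fun s hs => ?_⟩
  rw [← norm_mul]
  by_cases hin : s ∈ Set.Icc (-c) 1 ×ℂ Set.Icc (-1) 1
  · exact (hB1 s hin).trans (le_max_left _ _)
  refine le_trans ?_ (le_max_right _ _)
  have hs' : -d < s.re := by linarith
  have hout : 1 < s.re ∨ (s.re ≤ 1 ∧ 1 < |s.im|) := by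
    by_contra hcon
    push Not at hcon
    have h2 := hcon.2 hcon.1
    rw [abs_le] at h2
    exact hin (Complex.mem_reProdIm.2 ⟨⟨hs, hcon.1⟩, h2⟩)
  have hhf : 1 / 17 ≤ ‖hf s‖ := by
    rcases hout with h | ⟨h1, h2⟩
    · have := (hf_re s h.le).trans (Complex.re_le_norm _)
      linarith
    · exact hf_im_lower d hd1 hd2 hs' h1 h2.le
  have hnorm : ∀ x : ℝ, x ≤ 0 → 1 ≤ ‖s - x‖ := by
    intro x hx
    rcases hout with h | ⟨h1, h2⟩
    · have := Complex.re_le_norm (s - x)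
      simp at this
      linarith
    · have := Complex.abs_im_le_norm (s - x)
      simp at this
      linarith
  have hn0 : 1 ≤ ‖s‖ := by simpa using hnorm 0 le_rfl
  have hnσ : 1 ≤ ‖s - σ‖ := hnorm σ (by linarith [hσ.2])
  have hn1 : 1 ≤ ‖1 + s‖ := by have := hnorm (-1) (by norm_num); simpa [add_comm] using this
  have hs0 : s ≠ 0 := by rintro rfl; simp at hn0; linarith
  have hsσ : s - σ ≠ 0 := by intro h; rw [h, norm_zero] at hnσ; linarith
  have hs1 : 1 + s ≠ 0 := by intro h; rw [h, norm_zero] at hn1; linarith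
  have hhf0 : hf s ≠ 0 := by intro h; rw [h, norm_zero] at hhf; linarith
  have hMh := Mf_hf s hs1
  have hM0 : Mf s ≠ 0 := by
    have := mul_ne_zero hs1 hhf0
    rw [← hMh] at this
    exact right_ne_zero_of_mul this
  have heq := gf_eq σ d hd1 hd2 hσd' hσ hroot hs' (sub_ne_zero.1 hsσ)
  have hnf := nf_eq d hd1 hd2 hs'
  have hexp : gf σ s * s = (hf s)⁻¹ - c2 / s - c1 - qf σ σ * (s / (s - σ)) := by
    have h1 : gf σ s = nf s / Mf s - qf σ σ * (1 / (s - σ)) := by rw [heq]; ring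
    have h2 : nf s = ((1 + s) - (c2 + c1 * s) * Mf s) / s ^ 2 := by
      rw [← hnf]; field_simp
    have h3 : Mf s = (1 + s) * hf s / s := by rw [← hMh]; field_simp
    have h4 : nf s / Mf s * s = (hf s)⁻¹ - c2 / s - c1 := by
      rw [h2, h3]; field_simp; ring
    rw [h1, sub_mul, h4]
    ring
  rw [hexp]
  have b1 : ‖(hf s)⁻¹‖ ≤ 17 := by
    rw [norm_inv]
    apply inv_le_of_inv_le₀ (by norm_num)
    linarith
  have b2 : ‖(c2 : ℂ) / s‖ ≤ |c2| := by
    rw [norm_div, Complex.norm_real, Real.norm_eq_abs]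
    exact div_le_self (abs_nonneg _) hn0
  have b3 : ‖(c1 : ℂ)‖ ≤ |c1| := by rw [Complex.norm_real, Real.norm_eq_abs]
  have b4 : ‖s / (s - σ)‖ ≤ 1 + |σ| := by
    have : s / (s - σ) = 1 + σ / (s - σ) := by field_simp; ring
    rw [this]
    refine (norm_add_le _ _).trans ?_
    rw [norm_one, norm_div, Complex.norm_real, Real.norm_eq_abs]
    have := div_le_self (abs_nonneg σ) hnσ
    linarith
  have b5 : ‖qf σ σ * (s / (s - σ))‖ ≤ ‖qf σ σ‖ * (1 + |σ|) := by
    rw [norm_mul]; gcongr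
  have t1 := norm_sub_le ((hf s)⁻¹ - c2 / s - c1) (qf σ σ * (s / (s - σ)))
  have t2 := norm_sub_le ((hf s)⁻¹ - c2 / s) (c1 : ℂ)
  have t3 := norm_sub_le ((hf s)⁻¹) (c2 / s)
  linarith

noncomputable def t0 : ℝ := zeta3 ^ 2 / z2 ^ 3 - 2 / 5

noncomputable def Tr (i : ℕ) : ℝ :=
  1 / (i * harm i) - c2 * (1 / (i : ℝ) ^ 2) - c1 * (1 / (i : ℝ)) + (if i = 0 then t0 else 0)

theorem Tr_eq (i : ℕ) : nf (i : ℂ) / Mf (i : ℂ) = (Tr i : ℂ) := by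
  have hs : -(1 : ℝ) < ((i : ℂ)).re := by
    have : (0 : ℝ) ≤ i := i.cast_nonneg
    simp only [Complex.natCast_re]; linarith
  rcases i with _ | m
  · have hM : Mf ((0 : ℕ) : ℂ) = (z2 : ℂ) := by
      unfold Mf
      rw [Q_expand 1 le_rfl (by norm_num) hs]
      unfold z2
      push_cast
      ring
    rw [hM]
    unfold nf Tr t0
    push_cast
    rw [V_zero]
    have hz : (z2 : ℂ) ≠ 0 := by exact_mod_cast z2_pos.ne'
    have e : ((Real.pi ^ 4 / 90 - 1 : ℝ) : ℂ) = 2 / 5 * (z2 : ℂ) ^ 2 - 1 := by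
      unfold z2; push_cast; ring
    rw [e]
    unfold c1 c2
    push_cast
    simp
    field_simp
  · have h1 := nf_eq 1 le_rfl (by norm_num) hs
    have hp := harm_pos m
    have hi : (((m + 1 : ℕ) : ℕ) : ℂ) ≠ 0 := by exact_mod_cast Nat.succ_ne_zero m
    have hi1 : 1 + ((m + 1 : ℕ) : ℂ) ≠ 0 := by
      have : ((1 + (m + 1) : ℕ) : ℂ) ≠ 0 := Nat.cast_ne_zero.2 (by omega)
      push_cast at this ⊢
      exact this
    have h2 := Mf_hf ((m + 1 : ℕ) : ℂ) hi1
    rw [hf_nat] at h2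
    have hh : (harm (m + 1) : ℂ) ≠ 0 := by exact_mod_cast hp.ne'
    have hM : Mf ((m + 1 : ℕ) : ℂ) ≠ 0 := by
      have := mul_ne_zero hi1 hh
      rw [← h2] at this
      exact right_ne_zero_of_mul this
    unfold Tr
    simp only [Nat.succ_ne_zero, if_false, add_zero]
    generalize hx : ((m + 1 : ℕ) : ℂ) = x at *
    have hxr : (((m + 1 : ℕ) : ℝ) : ℂ) = x := by rw [← hx]; push_cast; rfl
    rw [Complex.ofReal_sub, Complex.ofReal_sub, Complex.ofReal_mul, Complex.ofReal_mul,
      Complex.ofReal_div, Complex.ofReal_div, Complex.ofReal_div, Complex.ofReal_mul,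
      Complex.ofReal_pow, hxr]
    push_cast
    have h3 : 1 / (x * (harm (m + 1) : ℂ)) = (1 + x) / (x ^ 2 * Mf x) := by
      have : x ^ 2 * Mf x = x * ((1 + x) * (harm (m + 1) : ℂ)) := by rw [← h2]; ring
      rw [this]
      field_simp
    rw [h3, div_eq_iff hM]
    have h4 : nf x = (1 + x - (c2 + c1 * x) * Mf x) / x ^ 2 := by
      rw [← h1]; field_simp
    rw [h4]
    field_simp
    ring

theorem altSum_Tr (N : ℕ) : altSum N Tr
    = - L (N + 1) + c2 * ((harm N ^ 2 + harm2 N) / 2) + c1 * harm N + t0 := by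
  have e1 : altSum N Tr = altSum N (fun i => 1 / (i * harm i))
      - c2 * altSum N (fun i => (1 : ℝ) / (i : ℝ) ^ 2) - c1 * altSum N (fun i => (1 : ℝ) / i)
      + altSum N (fun i => if i = 0 then t0 else 0) := by
    unfold altSum Tr
    rw [Finset.mul_sum, Finset.mul_sum, ← Finset.sum_sub_distrib, ← Finset.sum_sub_distrib,
      ← Finset.sum_add_distrib]
    refine Finset.sum_congr rfl fun i _ => ?_
    ring
  have e2 : altSum N (fun i => if i = 0 then t0 else 0) = t0 := by
    unfold altSum
    rw [Finset.sum_eq_single 0]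
    · simp
    · intro b _ hb; simp [hb]
    · intro h; simp at h
  rw [e1, e2, altSum_one_div, altSum_one_div_sq, L_eq]
  ring

theorem trigamma_eq (N : ℕ) : trigamma ((N + 1 : ℕ) : ℝ) = z2 - harm2 N := by
  have h := hasSum_zeta_two
  have h' := (hasSum_nat_add_iff' (N + 1)).2 h
  unfold trigamma z2 harm2
  rw [Finset.sum_range_succ'] at h'
  have := h'.tsum_eq
  simp only [Nat.cast_zero, ne_eq, OfNat.ofNat_ne_zero, not_false_eq_true, zero_pow, div_zero,
    add_zero] at this
  push_cast at this ⊢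
  rw [← this]
  refine tsum_congr fun k => ?_
  congr 2
  ring

theorem main_identity (N : ℕ) :
    L (N + 1) - (3 / Real.pi ^ 2) * harm N ^ 2
          - (zeta3 / (Real.pi ^ 2 / 6) ^ 2) * harm N
          - zeta3 ^ 2 / (Real.pi ^ 2 / 6) ^ 3 - 1 / 10
          + (3 / Real.pi ^ 2) * trigamma ((N + 1 : ℕ) : ℝ) = - altSum N Tr := by
  rw [altSum_Tr, trigamma_eq]
  have h3 : (3 : ℝ) / Real.pi ^ 2 = 1 / (2 * z2) := by
    unfold z2; have := Real.pi_pos; field_simp; norm_num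
  rw [h3]
  change _ - zeta3 / z2 ^ 2 * _ - zeta3 ^ 2 / z2 ^ 3 - _ + _ = _
  unfold t0 c1 c2
  have := z2_pos.ne'
  field_simp
  ring

theorem beta_bound (a : ℝ) (ha : 0 < a) : ∃ G : ℝ, 0 ≤ G ∧ ∀ n : ℕ, 1 ≤ n →
    (n.factorial : ℝ) / ∏ k ∈ Finset.range (n + 1), (a + (k : ℝ)) ≤ G * (n : ℝ) ^ (-a) := by
  obtain ⟨G, hG⟩ := (Real.GammaSeq_tendsto_Gamma a).bddAbove_range
  refine ⟨max G 0, le_max_right _ _, fun n hn => ?_⟩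
  have hn' : (0 : ℝ) < n := by exact_mod_cast hn
  have h := hG (Set.mem_range_self n)
  unfold Real.GammaSeq at h
  rw [mul_div_assoc] at h
  have h2 := h.trans (le_max_left G 0)
  rw [Real.rpow_neg hn'.le, ← div_eq_mul_inv, le_div_iff₀ (Real.rpow_pos_of_pos hn' a), mul_comm]
  exact h2

theorem altSum_Tr_bound (σ : ℝ) (hσ : σ ∈ Set.Ioo (-2 : ℝ) (-1))
    (hroot : digamma (σ + 1) = digamma 1) :
    ∃ K : ℝ, 0 ≤ K ∧ ∀ N : ℕ, |altSum N Tr| ≤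
      K * ((N.factorial : ℝ) / ∏ k ∈ Finset.range (N + 1), (-σ + (k : ℝ))) := by
  obtain ⟨h1, h2⟩ := hσ
  obtain ⟨c, hc⟩ : ∃ c : ℝ, c = (2 + 2 * -σ) / 3 := ⟨_, rfl⟩
  obtain ⟨d, hd⟩ : ∃ d : ℝ, d = (c + 2) / 2 := ⟨_, rfl⟩
  have hσc : -σ < c := by linarith
  have hcd : c < d := by linarith
  have hd2 : d < 2 := by linarith
  have hd1 : 1 ≤ d := by linarith
  have hc0 : 0 < c := by linarith
  obtain ⟨B, hB⟩ := gf_bound σ c d (by linarith) hcd hd2 (by linarith) ⟨h1, h2⟩ hroot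
  have hB0 : 0 ≤ B := by
    have := hB 0 (by simp; linarith)
    simpa using this
  refine ⟨‖qf σ σ‖ + B, by positivity, fun N => ?_⟩
  have hr := rice_bound (gf σ) c d B hc0 hcd (gf_diff σ d hd1 hd2 (by linarith) ⟨h1, h2⟩ hroot) hB N
  have hprod : (N.factorial : ℝ) / ∏ k ∈ Finset.range (N + 1), (c + (k : ℝ))
      ≤ (N.factorial : ℝ) / ∏ k ∈ Finset.range (N + 1), (-σ + (k : ℝ)) := by
    apply div_le_div_of_nonneg_left (by positivity)
    · refine Finset.prod_pos fun k _ => ?_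
      have : (0 : ℝ) ≤ k := k.cast_nonneg
      linarith
    · refine Finset.prod_le_prod (fun k _ => ?_) (fun k _ => ?_)
      · have : (0 : ℝ) ≤ k := k.cast_nonneg
        linarith
      · linarith
  have hinv := altSum_inv N (-(σ : ℂ)) (fun k _ h => by
    have h' := congrArg Complex.re h
    have : (0 : ℝ) ≤ k := k.cast_nonneg
    simp at h'
    linarith)
  have hT : ((altSum N Tr : ℝ) : ℂ) = qf σ σ * altSum N (fun i => 1 / (-(σ : ℂ) + i))
      + altSum N (fun i => gf σ i) := by
    unfold altSum
    rw [Finset.mul_sum, ← Finset.sum_add_distrib]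
    push_cast
    refine Finset.sum_congr rfl fun i _ => ?_
    have hi : (0 : ℝ) ≤ i := i.cast_nonneg
    rw [← Tr_eq, gf_eq σ d hd1 hd2 (by linarith) ⟨h1, h2⟩ hroot (s := (i : ℂ))
      (by simp only [Complex.natCast_re]; linarith)
      (fun h => by
        have := congrArg Complex.re h
        simp at this
        linarith)]
    rw [show (-(σ : ℂ) + i) = i - σ by ring]
    ring
  have hnorm : ‖altSum N (fun i => 1 / (-(σ : ℂ) + i))‖
      = (N.factorial : ℝ) / ∏ k ∈ Finset.range (N + 1), (-σ + (k : ℝ)) := by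
    rw [hinv]
    have : ((N.factorial : ℂ) / ∏ k ∈ Finset.range (N + 1), (-(σ : ℂ) + k))
        = (((N.factorial : ℝ) / ∏ k ∈ Finset.range (N + 1), (-σ + (k : ℝ)) : ℝ) : ℂ) := by
      push_cast; rfl
    rw [this, Complex.norm_real, Real.norm_eq_abs, abs_of_nonneg]
    refine div_nonneg (by positivity) (Finset.prod_nonneg fun k _ => ?_)
    have : (0 : ℝ) ≤ k := k.cast_nonneg
    linarith
  have : |altSum N Tr| = ‖((altSum N Tr : ℝ) : ℂ)‖ := by
    rw [Complex.norm_real, Real.norm_eq_abs]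
  rw [this, hT]
  calc _ ≤ _ := norm_add_le _ _
    _ ≤ ‖qf σ σ‖ * ((N.factorial : ℝ) / ∏ k ∈ Finset.range (N + 1), (-σ + (k : ℝ)))
        + B * ((N.factorial : ℝ) / ∏ k ∈ Finset.range (N + 1), (-σ + (k : ℝ))) := by
      rw [norm_mul, hnorm]
      have := mul_le_mul_of_nonneg_left hprod hB0
      linarith
    _ = _ := by ring

/--
With `A(n,j)` as above and `L(n) := Σ_{j=2}^n A(n,j)`, there is a constant `C` such that for
all `n ≥ 2`,
`|L(n) - (3/π²)·h_{n-1}² - (ζ(3)/ζ(2)²)·h_{n-1} - ζ(3)²/ζ(2)³ - 1/10 + (3/π²)·ψ'(n)|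
  ≤ C · n^{-1-|s₁|}`,
where `ψ'(n) = Σ_{k=0}^∞ 1/(n+k)²` is the trigamma function at `n`, `ζ(2) = π²/6`,
`ζ(3) = Σ_{k≥1} k⁻³`, and `s₁ ∈ (-1,0)` is the unique root of `ψ(s) = ψ(1)` in `(-1,0)`.
-/
theorem stmt15 (s₁ : ℝ) (hs₁ : s₁ ∈ Set.Ioo (-1:ℝ) 0) (hroot : digamma s₁ = digamma 1) :
    ∃ C : ℝ, ∀ n : ℕ, 2 ≤ n →
      |L n - (3 / Real.pi ^ 2) * harm (n - 1) ^ 2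
          - (zeta3 / (Real.pi ^ 2 / 6) ^ 2) * harm (n - 1)
          - zeta3 ^ 2 / (Real.pi ^ 2 / 6) ^ 3 - 1 / 10
          + (3 / Real.pi ^ 2) * trigamma (n : ℝ)|
        ≤ C * (n : ℝ) ^ (-1 - |s₁|) := by
  have hσ : s₁ - 1 ∈ Set.Ioo (-2 : ℝ) (-1) := ⟨by linarith [hs₁.1], by linarith [hs₁.2]⟩
  obtain ⟨K, hK0, hK⟩ := altSum_Tr_bound (s₁ - 1) hσ (by rw [sub_add_cancel]; exact hroot)
  obtain ⟨G, hG0, hG⟩ := beta_bound (-(s₁ - 1)) (by linarith [hs₁.2])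
  refine ⟨K * (G * 2 ^ (-(s₁ - 1))), fun n hn => ?_⟩
  obtain ⟨N, rfl⟩ : ∃ N, n = N + 1 := ⟨n - 1, by omega⟩
  have hN : 1 ≤ N := by omega
  have hNr : (1 : ℝ) ≤ N := by exact_mod_cast hN
  have e : -1 - |s₁| = s₁ - 1 := by rw [abs_of_neg hs₁.2]; ring
  rw [Nat.add_sub_cancel, main_identity, abs_neg, e]
  have h2 : ((N : ℝ)) ^ (s₁ - 1) ≤ 2 ^ (-(s₁ - 1)) * ((N + 1 : ℕ) : ℝ) ^ (s₁ - 1) := by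
    rw [Real.rpow_neg (by norm_num), mul_comm, ← div_eq_mul_inv,
      ← Real.div_rpow (by positivity) (by norm_num)]
    apply Real.rpow_le_rpow_of_nonpos (by positivity) _ (by linarith [hs₁.2])
    push_cast
    linarith
  have h3 := hG N hN
  rw [neg_neg] at h3
  calc _ ≤ _ := hK N
    _ ≤ K * (G * (N : ℝ) ^ (s₁ - 1)) := mul_le_mul_of_nonneg_left h3 hK0
    _ ≤ K * (G * (2 ^ (-(s₁ - 1)) * ((N + 1 : ℕ) : ℝ) ^ (s₁ - 1))) := by gcongr
    _ = _ := by ring
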